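/- arXiv:1709.09764 — 2 statements merged into one kernel-verified Lean document; each statement's English description precedes it below -/
import Mathlib

section
/- Let A = ⊕_{i≥0} A_i be a finite dimensional graded algebra over a field with A_0 semisimple and A generated by A_0 and A_1. Let M be a finite dimensional graded A-module with simple socle. Then the socle filtration of M coincides with the grading filtration: soc_i(M) = ⊕_{j > d−i} M_j where d is the maximal degree with M_d ≠ 0 (after normalizing the grading). In particular ll(M) = gl(M). -/
open Submodule

section Defs
variable (R : Type*) [Ring R] (M : Type*) [AddCommGroup M] [Module R M]

/-- `F` is a filtration of `M` by submodules with semisimple subquotients. -/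
def IsSemisimpleFiltration {n : ℕ} (F : Fin (n+1) → Submodule R M) : Prop :=
  Monotone F ∧ F 0 = ⊥ ∧ F (Fin.last n) = ⊤ ∧
    ∀ i : Fin n,
      IsSemisimpleModule R
        (↥(F i.succ) ⧸ (Submodule.comap (F i.succ).subtype (F i.castSucc)))

/-- The Loewy length: minimal length of a semisimple filtration. -/
noncomputable def loewyLength : ℕ :=
  sInf {n : ℕ | ∃ F : Fin (n+1) → Submodule R M, IsSemisimpleFiltration R M F}

/-- The socle filtration. -/
def socFilt : ℕ → Submodule R M
  | 0 => ⊥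
  | k+1 => Submodule.comap (socFilt k).mkQ
      (sSup {S : Submodule R (M ⧸ socFilt k) | IsSimpleModule R ↥S})

/-- The radical filtration. -/
def radFilt : ℕ → Submodule R M
  | 0 => ⊤
  | k+1 => Submodule.map (radFilt k).subtype
      (sInf {P : Submodule R ↥(radFilt k) | IsCoatom P})

/-- `S` occurs as a subquotient of `X`. -/
def OccursIn (S : Type*) [AddCommGroup S] [Module R S]
    (X : Type*) [AddCommGroup X] [Module R X] : Prop :=
  ∃ (N P : Submodule R X), P ≤ N ∧
    Nonempty ((↥N ⧸ Submodule.comap N.subtype P) ≃ₗ[R] S)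

/-- multiplicity of `S` among the factors of a composition series. -/
noncomputable def multIn (s : CompositionSeries (Submodule R M))
    (S : Type*) [AddCommGroup S] [Module R S] : ℕ :=
  Nat.card {i : Fin s.length //
    Nonempty ((↥(s i.succ) ⧸ Submodule.comap (s i.succ).subtype (s i.castSucc)) ≃ₗ[R] S)}

end Defs


section Helpers

variable {k : Type} [Field k] {A : Type} [Ring A] [Algebra k A]
  (𝒜 : ℕ → Submodule k A) [GradedRing 𝒜]

/-- The elements killed by all homogeneous elements of positive degree. -/
def killed (N : Type*) [AddCommGroup N] [Module A N] : Submodule A N where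
  carrier := {m | ∀ n > 0, ∀ a ∈ 𝒜 n, a • m = 0}
  zero_mem' := by intro n _ a _; simp
  add_mem' := by
    intro x y hx hy n hn a ha
    rw [smul_add, hx n hn a ha, hy n hn a ha, add_zero]
  smul_mem' := by
    intro c x hx n hn a ha
    rw [← mul_smul]
    refine DirectSum.Decomposition.inductionOn 𝒜 (motive := fun c => (a * c) • x = 0) ?_ ?_ ?_ c
    · simp
    · intro i m
      exact hx (n + i) (by omega) _ (SetLike.mul_mem_graded ha m.2)
    · intro c d hc hd
      rw [mul_add, add_smul, hc, hd, add_zero]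

theorem mem_killed {N : Type*} [AddCommGroup N] [Module A N] {m : N} :
    m ∈ killed 𝒜 N ↔ ∀ n > 0, ∀ a ∈ 𝒜 n, a • m = 0 := Iff.rfl

theorem smul_eq_zero_part {N : Type*} [AddCommGroup N] [Module A N] {m : N}
    (hm : m ∈ killed 𝒜 N) (a : A) :
    a • m = (GradedRing.projZeroRingHom' 𝒜 a : A) • m := by
  refine DirectSum.Decomposition.inductionOn 𝒜
    (motive := fun a => a • m = (GradedRing.projZeroRingHom' 𝒜 a : A) • m) ?_ ?_ ?_ a
  · simp
  · intro i a
    rcases Nat.eq_zero_or_pos i with rfl | hi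
    · rw [GradedRing.projZeroRingHom'_apply_coe]
    · rw [hm i hi a a.2, GradedRing.coe_projZeroRingHom'_apply, GradedRing.projZeroRingHom_apply,
        DirectSum.decompose_of_mem_ne 𝒜 a.2 (by omega), zero_smul]
  · intro a b ha hb
    rw [add_smul, ha, hb, map_add, ← add_smul]
    rfl

theorem semisimple_of_killed (hA0 : IsSemisimpleRing ↥(𝒜 0))
    (N : Type*) [AddCommGroup N] [Module A N] (h : ∀ m : N, m ∈ killed 𝒜 N) :
    IsSemisimpleModule A N := by
  let : Module (𝒜 0) N :=
    { smul := fun a x => (a : A) • x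
      one_smul := fun x => one_smul A x
      mul_smul := fun a b x => mul_smul (a : A) (b : A) x
      smul_zero := fun a => smul_zero (a : A)
      smul_add := fun a x y => smul_add (a : A) x y
      add_smul := fun a b x => add_smul (a : A) (b : A) x
      zero_smul := fun x => zero_smul A x }
  have : RingHomSurjective (GradedRing.projZeroRingHom' 𝒜) :=
    ⟨GradedRing.projZeroRingHom'_surjective 𝒜⟩
  let f : N →ₛₗ[GradedRing.projZeroRingHom' 𝒜] N :=
    { toFun := id
      map_add' := fun _ _ => rfl
      map_smul' := fun a x => smul_eq_zero_part 𝒜 (h x) a }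
  exact (f.isSemisimpleModule_iff_of_bijective Function.bijective_id).mpr inferInstance

theorem exists_bound [FiniteDimensional k A] : ∃ n, ∀ j > n, 𝒜 j = ⊥ := by
  have h1 : iSupIndep 𝒜 := (DirectSum.Decomposition.isInternal 𝒜).submodule_iSupIndep
  have h2 := WellFoundedGT.finite_ne_bot_of_iSupIndep h1
  obtain ⟨n, hn⟩ := h2.bddAbove
  refine ⟨n, fun j hj => ?_⟩
  by_contra hc
  exact absurd (hn hc) (by omega)

theorem simple_le_killed [FiniteDimensional k A]
    {N : Type*} [AddCommGroup N] [Module A N] (S : Submodule A N) (hS : IsSimpleModule A S) :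
    S ≤ killed 𝒜 N := by
  have hat : IsAtom S := isSimpleModule_iff_isAtom.mp hS
  rcases hat.le_iff.mp (inf_le_left : S ⊓ killed 𝒜 N ≤ S) with h | h
  · obtain ⟨B, hB⟩ := exists_bound 𝒜
    have key : ∀ t n, 0 < n → B < n + t → ∀ a ∈ 𝒜 n, ∀ x ∈ S, a • x = 0 := by
      intro t
      induction t with
      | zero =>
        intro n hn hb a ha x hx
        rw [hB n (by omega)] at ha
        rw [(Submodule.mem_bot k).mp ha, zero_smul]
      | succ t ih =>
        intro n hn hb a ha x hx
        have : a • x ∈ S ⊓ killed 𝒜 N := by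
          refine ⟨S.smul_mem a hx, ?_⟩
          intro i hi b hbi
          rw [← mul_smul]
          exact ih (i + n) (by omega) (by omega) _ (SetLike.mul_mem_graded hbi ha) x hx
        rw [h] at this
        exact (Submodule.mem_bot A).mp this
    intro x hx n hn a ha
    exact key (B + 1) n hn (by omega) a ha x hx
  · exact inf_eq_left.mp h

theorem socle_eq_killed [FiniteDimensional k A] (hA0 : IsSemisimpleRing ↥(𝒜 0))
    (N : Type*) [AddCommGroup N] [Module A N] :
    sSup {S : Submodule A N | IsSimpleModule A ↥S} = killed 𝒜 N := by
  apply le_antisymm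
  · exact sSup_le fun S hS => simple_le_killed 𝒜 S hS
  · have : IsSemisimpleModule A (killed 𝒜 N) := by
      apply semisimple_of_killed 𝒜 hA0
      intro m n hn a ha
      exact Subtype.ext (m.2 n hn a ha)
    have h1 : killed 𝒜 N = Submodule.map (killed 𝒜 N).subtype
        (sSup {S : Submodule A (killed 𝒜 N) | IsSimpleModule A ↥S}) := by
      rw [IsSemisimpleModule.sSup_simples_eq_top, Submodule.map_subtype_top]
    rw [h1, sSup_eq_iSup, Submodule.map_iSup]
    refine iSup_le fun S => ?_
    rw [Submodule.map_iSup]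
    refine iSup_le fun hS => le_sSup ?_
    have hS' : IsSimpleModule A ↥S := hS
    exact (LinearEquiv.isSimpleModule_iff
      (Submodule.equivMapOfInjective _ (killed 𝒜 N).injective_subtype S)).mp hS'

theorem killed_of_semisimple [FiniteDimensional k A] (hA0 : IsSemisimpleRing ↥(𝒜 0))
    (N : Type*) [AddCommGroup N] [Module A N] [IsSemisimpleModule A N] (m : N) :
    m ∈ killed 𝒜 N := by
  rw [← socle_eq_killed 𝒜 hA0, IsSemisimpleModule.sSup_simples_eq_top]
  trivial

theorem mem_socFilt_succ [FiniteDimensional k A] (hA0 : IsSemisimpleRing ↥(𝒜 0))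
    (N : Type*) [AddCommGroup N] [Module A N] (i : ℕ) (m : N) :
    m ∈ socFilt A N (i + 1) ↔ ∀ n > 0, ∀ a ∈ 𝒜 n, a • m ∈ socFilt A N i := by
  rw [socFilt, Submodule.mem_comap, socle_eq_killed 𝒜 hA0, mem_killed]
  simp only [Submodule.mkQ_apply, ← Submodule.Quotient.mk_smul, Submodule.Quotient.mk_eq_zero]

theorem killed_of_deg_one (hgen : Algebra.adjoin k ((𝒜 0 : Set A) ∪ (𝒜 1 : Set A)) = ⊤)
    {N : Type*} [AddCommGroup N] [Module A N] {x : N} (hx : ∀ a ∈ 𝒜 1, a • x = 0) :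
    x ∈ killed 𝒜 N := by
  have key : ∀ a : A, ∀ x : N, (∀ c ∈ 𝒜 1, c • x = 0) →
      a • x = (GradedRing.projZeroRingHom' 𝒜 a : A) • x := by
    intro a
    have ha : a ∈ Algebra.adjoin k ((𝒜 0 : Set A) ∪ (𝒜 1 : Set A)) := by rw [hgen]; trivial
    induction ha using Algebra.adjoin_induction with
    | mem a ha =>
      intro x hx
      rcases ha with ha | ha
      · exact congrArg (fun z : 𝒜 0 => (z : A) • x)
          (GradedRing.projZeroRingHom'_apply_coe 𝒜 ⟨a, ha⟩).symm
      · rw [hx a ha, GradedRing.coe_projZeroRingHom'_apply, GradedRing.projZeroRingHom_apply,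
          DirectSum.decompose_of_mem_ne 𝒜 ha (by omega), zero_smul]
    | algebraMap r =>
      intro x hx
      exact congrArg (fun z : 𝒜 0 => (z : A) • x)
        (GradedRing.projZeroRingHom'_apply_coe 𝒜
          ⟨algebraMap k A r, SetLike.algebraMap_mem_graded 𝒜 r⟩).symm
    | add a b _ _ ha hb =>
      intro x hx
      rw [add_smul, ha x hx, hb x hx, map_add, ← add_smul]
      rfl
    | mul a b _ _ ha hb =>
      intro x hx
      rw [mul_smul, hb x hx, ha, map_mul, ← mul_smul]
      · rfl
      · intro c hc
        rw [← mul_smul]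
        exact hx _ (by simpa using SetLike.mul_mem_graded hc (GradedRing.projZeroRingHom' 𝒜 b).2)
  intro n hn a ha
  rw [key a x hx, GradedRing.coe_projZeroRingHom'_apply, GradedRing.projZeroRingHom_apply,
    DirectSum.decompose_of_mem_ne 𝒜 ha (by omega), zero_smul]

variable {M : Type} [AddCommGroup M] [Module A M] [Module k M]
  (ℳ : ℤ → Submodule k M) [DirectSum.Decomposition ℳ]

theorem decompose_smul_comp
    (hcompat : ∀ (i : ℕ) (j : ℤ) (a : A) (m : M),
      a ∈ 𝒜 i → m ∈ ℳ j → a • m ∈ ℳ ((i : ℤ) + j))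
    (n : ℕ) (a : A) (ha : a ∈ 𝒜 n) (m : M) (j : ℤ) :
    (DirectSum.decompose ℳ (a • m) j : M) = a • (DirectSum.decompose ℳ m (j - n) : M) := by
  refine DirectSum.Decomposition.inductionOn ℳ
    (motive := fun m => (DirectSum.decompose ℳ (a • m) j : M)
      = a • (DirectSum.decompose ℳ m (j - n) : M)) ?_ ?_ ?_ m
  · simp
  · intro i m
    have h := hcompat n i a m ha m.2
    by_cases hij : i = j - n
    · subst hij
      rw [DirectSum.decompose_of_mem_same ℳ m.2]
      rw [show (n : ℤ) + (j - n) = j by ring] at h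
      rw [DirectSum.decompose_of_mem_same ℳ h]
    · rw [DirectSum.decompose_of_mem_ne ℳ m.2 hij,
        DirectSum.decompose_of_mem_ne ℳ h (by omega), smul_zero]
  · intro x y hx hy
    simp only [smul_add, DirectSum.decompose_add, DirectSum.add_apply, Submodule.coe_add, hx, hy]

theorem mem_tail_iff (c : ℤ) (m : M) :
    m ∈ (⨆ j > c, ℳ j) ↔ ∀ j ≤ c, (DirectSum.decompose ℳ m j : M) = 0 := by
  classical
  constructor
  · intro h j hj
    have hle : (⨆ j > c, ℳ j) ≤
        LinearMap.ker ((ℳ j).subtype ∘ₗ DirectSum.component k ℤ (fun i => ℳ i) j ∘ₗ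
          (DirectSum.decomposeLinearEquiv ℳ).toLinearMap) := by
      refine iSup₂_le fun i hi x hx => ?_
      rw [LinearMap.mem_ker]
      exact DirectSum.decompose_of_mem_ne ℳ hx (by omega)
    exact hle h
  · intro h
    rw [← DirectSum.sum_support_decompose ℳ m]
    refine Submodule.sum_mem _ fun j _ => ?_
    by_cases hj : j ≤ c
    · rw [h j hj]; exact Submodule.zero_mem _
    · exact (le_iSup₂ (f := fun j (_ : j > c) => ℳ j) j (by omega)) (SetLike.coe_mem _)

theorem eq_zero_of_comp (m : M) (h : ∀ j, (DirectSum.decompose ℳ m j : M) = 0) : m = 0 := by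
  classical
  rw [← DirectSum.sum_support_decompose ℳ m]
  exact Finset.sum_eq_zero fun j _ => h j

end Helpers

/-- for a finite dimensional graded algebra `A` with `A_0` semisimple,
generated by `A_0` and `A_1`, and a finite dimensional graded module `M` with simple
socle, the socle filtration coincides with the grading filtration:
`soc_i M = ⊕_{j > dtop − i} M_j`; in particular `ll(M) = gl(M)`. -/
theorem stmt7 (k : Type) [Field k] (A : Type) [Ring A] [Algebra k A]
    [FiniteDimensional k A]
    (𝒜 : ℕ → Submodule k A) [GradedRing 𝒜] (hA0 : IsSemisimpleRing ↥(𝒜 0))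
    (hgen : Algebra.adjoin k ((𝒜 0 : Set A) ∪ (𝒜 1 : Set A)) = ⊤)
    (M : Type) [AddCommGroup M] [Module A M] [Module k M] [IsScalarTower k A M]
    [FiniteDimensional k M]
    (ℳ : ℤ → Submodule k M) [DirectSum.Decomposition ℳ]
    (hcompat : ∀ (i : ℕ) (j : ℤ) (a : A) (m : M),
      a ∈ 𝒜 i → m ∈ ℳ j → a • m ∈ ℳ ((i : ℤ) + j))
    (K dtop : ℤ)
    (hK : ℳ K ≠ ⊥ ∧ ∀ j < K, ℳ j = ⊥)
    (hdtop : ℳ dtop ≠ ⊥ ∧ ∀ j > dtop, ℳ j = ⊥)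
    (hsoc : IsSimpleModule A ↥(socFilt A M 1)) :
    (∀ i : ℕ, (socFilt A M i : Set M) = ↑(⨆ j > dtop - (i : ℤ), ℳ j)) ∧
    (loewyLength A M : ℤ) = dtop - K + 1 := by
  classical
  have soc1 : ∀ x : M, x ∈ killed 𝒜 M → x ∈ socFilt A M 1 := by
    intro x hx
    rw [mem_socFilt_succ 𝒜 hA0]
    intro n hn a ha
    rw [hx n hn a ha]
    exact Submodule.zero_mem _
  have top_killed : ∀ x ∈ ℳ dtop, x ∈ killed 𝒜 M := by
    intro x hx n hn a ha
    have := hcompat n dtop a x ha hx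
    rw [hdtop.2 _ (by omega)] at this
    exact (Submodule.mem_bot k).mp this
  have hsoc1 : ∀ y ∈ socFilt A M 1, y ∈ ℳ dtop := by
    intro y hy
    obtain ⟨x, hx, hx0⟩ := (Submodule.ne_bot_iff _).mp hdtop.1
    have hne : (⟨x, soc1 x (top_killed x hx)⟩ : socFilt A M 1) ≠ 0 := by
      intro h
      exact hx0 (congrArg Subtype.val h)
    obtain ⟨a, ha⟩ := IsSimpleModule.toSpanSingleton_surjective A hne ⟨y, hy⟩
    have ha' : a • x = y := congrArg Subtype.val ha
    rw [← ha', smul_eq_zero_part 𝒜 (top_killed x hx)]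
    simpa using hcompat 0 dtop _ x (GradedRing.projZeroRingHom' 𝒜 a).2 hx
  have main : ∀ i : ℕ, ∀ m : M, m ∈ socFilt A M i ↔
      ∀ j ≤ dtop - (i : ℤ), (DirectSum.decompose ℳ m j : M) = 0 := by
    intro i
    induction i with
    | zero =>
      intro m
      rw [socFilt, Submodule.mem_bot]
      constructor
      · rintro rfl j _
        simp
      · intro h
        refine eq_zero_of_comp ℳ m fun j => ?_
        by_cases hj : j ≤ dtop
        · exact h j (by simpa using hj)
        · have hm := (DirectSum.decompose ℳ m j).2
          exact (Submodule.mem_bot k).mp ((hdtop.2 j (by omega)).le hm)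
    | succ i ih =>
      intro m
      rw [mem_socFilt_succ 𝒜 hA0]
      constructor
      · intro h j hj
        push_cast at hj
        have hk : (DirectSum.decompose ℳ m j : M) ∈ killed 𝒜 M := by
          refine killed_of_deg_one 𝒜 hgen fun a ha => ?_
          have h1 := (ih _).mp (h 1 one_pos a ha) (j + 1) (by omega)
          rw [decompose_smul_comp 𝒜 ℳ hcompat 1 a ha] at h1
          rwa [show j + 1 - ((1 : ℕ) : ℤ) = j by push_cast; ring] at h1
        have h2 := hsoc1 _ (soc1 _ hk)
        have h3 := DirectSum.decompose_of_mem_ne ℳ h2 (show dtop ≠ j by omega)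
        rwa [DirectSum.decompose_of_mem_same ℳ (SetLike.coe_mem _)] at h3
      · intro h n hn a ha
        rw [ih]
        intro j hj
        rw [decompose_smul_comp 𝒜 ℳ hcompat n a ha, h _ (by push_cast; omega), smul_zero]
  refine ⟨fun i => ?_, ?_⟩
  · ext m
    rw [SetLike.mem_coe, SetLike.mem_coe, main, mem_tail_iff]
  have hKd : K ≤ dtop := by
    by_contra hc
    exact hdtop.1 (hK.2 dtop (by omega))
  obtain ⟨L, hL⟩ : ∃ L : ℕ, (L : ℤ) = dtop - K + 1 := ⟨(dtop - K + 1).toNat, by omega⟩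
  have hmem : L ∈ {n : ℕ | ∃ F : Fin (n+1) → Submodule A M, IsSemisimpleFiltration A M F} := by
    refine ⟨fun i => socFilt A M i, ?_, ?_, ?_, ?_⟩
    · intro i j hij m hm
      have hij' : (i : ℕ) ≤ j := hij
      rw [main] at hm ⊢
      exact fun t ht => hm t (by omega)
    · rfl
    · rw [eq_top_iff]
      intro m _
      rw [main]
      intro j hj
      have hm := (DirectSum.decompose ℳ m j).2
      rw [Fin.val_last] at hj
      exact (Submodule.mem_bot k).mp ((hK.2 j (by omega)).le hm)
    · intro i
      apply semisimple_of_killed 𝒜 hA0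
      intro q n hn a ha
      obtain ⟨⟨m, hm⟩, rfl⟩ := Submodule.Quotient.mk_surjective _ q
      rw [← Submodule.Quotient.mk_smul, Submodule.Quotient.mk_eq_zero]
      exact (mem_socFilt_succ 𝒜 hA0 M i m).mp hm n hn a ha
  have hle : ∀ n ∈ {n : ℕ | ∃ F : Fin (n+1) → Submodule A M, IsSemisimpleFiltration A M F},
      L ≤ n := by
    rintro n ⟨F, -, h0, hlast, hss⟩
    have hF : ∀ i : Fin (n + 1), F i ≤ socFilt A M i := by
      intro i
      induction i using Fin.induction with
      | zero => rw [h0]; exact bot_le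
      | succ i ih =>
        intro m hm
        refine (mem_socFilt_succ 𝒜 hA0 M i m).mpr fun t ht a ha => ih ?_
        have := hss i
        have h1 := killed_of_semisimple 𝒜 hA0 _
          (Submodule.Quotient.mk (p := Submodule.comap (F i.succ).subtype (F i.castSucc)) ⟨m, hm⟩)
          t ht a ha
        rw [← Submodule.Quotient.mk_smul, Submodule.Quotient.mk_eq_zero] at h1
        exact h1
    obtain ⟨x, hx, hx0⟩ := (Submodule.ne_bot_iff _).mp hK.1
    have hxn : x ∈ socFilt A M n := by
      have := hF (Fin.last n)
      rw [hlast] at this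
      exact this trivial
    by_contra hc
    have := (main n x).mp hxn K (by omega)
    rw [DirectSum.decompose_of_mem_same ℳ hx] at this
    exact hx0 this
  have : loewyLength A M = L :=
    le_antisymm (Nat.sInf_le hmem) (hle _ (Nat.sInf_mem ⟨L, hmem⟩))
  rw [this, hL]
end

section
/- Let A be a finite dimensional graded algebra over a field with A_0 semisimple and A generated by A_0 and A_1. If a finite dimensional graded A-module M has both simple top and simple socle, then M is rigid: its radical filtration and socle filtration coincide (both equal to the grading filtration). -/
open Submodule

section Mine
set_option linter.unusedSectionVars false
open DirectSum

section Abs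
variable {R : Type*} [Ring R] (J : Ideal R) [J.IsTwoSided]

lemma ss_of_killed (hss : IsSemisimpleRing (R ⧸ J)) (N : Type*) [AddCommGroup N] [Module R N]
    (h : ∀ a ∈ J, ∀ m : N, a • m = 0) : IsSemisimpleModule R N := by
  have hM : Module.IsTorsionBySet R N (J : Set R) := fun m a => h a a.2 m
  let := hM.module
  exact hM.isSemisimpleModule_iff.1 inferInstance

lemma killed_of_ss (hJ : J ≤ Ring.jacobson R) (N : Type*) [AddCommGroup N] [Module R N]
    [IsSemisimpleModule R N] : ∀ a ∈ J, ∀ m : N, a • m = 0 := by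
  intro a ha m
  exact Module.mem_annihilator.1 (IsSemisimpleModule.jacobson_le_annihilator R N (hJ ha)) m

lemma quot_killed {N : Type*} [AddCommGroup N] [Module R N] (P Q : Submodule R N)
    (h : ∀ a ∈ J, ∀ m ∈ P, a • m ∈ Q) :
    ∀ a ∈ J, ∀ m : (↥P ⧸ Submodule.comap P.subtype Q), a • m = 0 := by
  intro a ha m
  obtain ⟨m, rfl⟩ := Submodule.Quotient.mk_surjective _ m
  rw [← Submodule.Quotient.mk_smul, Submodule.Quotient.mk_eq_zero]
  exact h a ha m m.2

lemma of_quot_killed {N : Type*} [AddCommGroup N] [Module R N] (P Q : Submodule R N)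
    (h : ∀ a ∈ J, ∀ m : (↥P ⧸ Submodule.comap P.subtype Q), a • m = 0) :
    ∀ a ∈ J, ∀ m ∈ P, a • m ∈ Q := by
  intro a ha m hm
  have := h a ha (Submodule.Quotient.mk ⟨m, hm⟩)
  rw [← Submodule.Quotient.mk_smul, Submodule.Quotient.mk_eq_zero] at this
  exact this

lemma jac_eq (hss : IsSemisimpleRing (R ⧸ J)) (hJ : J ≤ Ring.jacobson R)
    (N : Type*) [AddCommGroup N] [Module R N] :
    Module.jacobson R N = J • (⊤ : Submodule R N) := by
  apply le_antisymm
  · apply Module.jacobson_le_of_eq_bot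
    have : IsSemisimpleModule R (N ⧸ (J • (⊤ : Submodule R N))) := by
      apply ss_of_killed J hss
      intro a ha m
      obtain ⟨m, rfl⟩ := Submodule.Quotient.mk_surjective _ m
      rw [← Submodule.Quotient.mk_smul, Submodule.Quotient.mk_eq_zero]
      exact Submodule.smul_mem_smul ha trivial
    exact IsSemisimpleModule.jacobson_eq_bot R _
  · exact le_trans (Submodule.smul_mono_left hJ) (Ring.jacobson_smul_top_le R N)

lemma rad_succ (hss : IsSemisimpleRing (R ⧸ J)) (hJ : J ≤ Ring.jacobson R)
    (N : Type*) [AddCommGroup N] [Module R N] (n : ℕ) :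
    radFilt R N (n+1) = J • radFilt R N n := by
  have := jac_eq J hss hJ (radFilt R N n)
  rw [Module.jacobson] at this
  rw [radFilt, this, Submodule.map_smul'', Submodule.map_top, Submodule.range_subtype]

lemma mem_soc_succ (hss : IsSemisimpleRing (R ⧸ J)) (hJ : J ≤ Ring.jacobson R)
    (N : Type*) [AddCommGroup N] [Module R N] (n : ℕ) (m : N) :
    m ∈ socFilt R N (n+1) ↔ ∀ a ∈ J, a • m ∈ socFilt R N n := by
  rw [socFilt, Submodule.mem_comap]
  set Q := N ⧸ socFilt R N n
  let K : Submodule R Q :=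
    { carrier := {q | ∀ a ∈ J, a • q = 0}
      add_mem' := fun {x y} hx hy a ha => by rw [smul_add, hx a ha, hy a ha, add_zero]
      zero_mem' := fun a _ => smul_zero a
      smul_mem' := fun c x hx a ha => by
        rw [smul_smul]; exact hx _ (J.mul_mem_right _ ha) }
  have hK : sSup {S : Submodule R Q | IsSimpleModule R ↥S} = K := by
    apply le_antisymm
    · apply sSup_le
      intro S hS q hq a ha
      have : IsSimpleModule R S := hS
      have := killed_of_ss J hJ S a ha ⟨q, hq⟩
      exact congrArg Subtype.val this
    · have : IsSemisimpleModule R K :=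
        ss_of_killed J hss K (fun a ha m => Subtype.ext (m.2 a ha))
      have h2 := IsSemisimpleModule.sSup_simples_eq_top R K
      have h3 : (⊤ : Submodule R K) ≤
          Submodule.comap K.subtype (sSup {S : Submodule R Q | IsSimpleModule R ↥S}) := by
        rw [← h2]
        refine sSup_le fun S hS => ?_
        have hS : IsSimpleModule R S := hS
        rw [← Submodule.map_le_iff_le_comap]
        apply le_sSup
        exact IsSimpleModule.congr (N := ↥S)
          (Submodule.equivMapOfInjective K.subtype K.injective_subtype S).symm
      intro q hq
      exact h3 (Submodule.mem_top (x := (⟨q, hq⟩ : K)))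
  rw [hK]
  constructor
  · intro h a ha
    have := h a ha
    rw [← map_smul] at this
    exact (Submodule.Quotient.mk_eq_zero _).1 this
  · intro h a ha
    rw [← map_smul]
    exact (Submodule.Quotient.mk_eq_zero _).2 (h a ha)
end Abs

section Alg
variable {k : Type*} [Field k] {A : Type*} [Ring A] [Algebra k A]
    (𝒜 : ℕ → Submodule k A) [GradedRing 𝒜]

lemma one_mem_sup (hgen : Algebra.adjoin k ((𝒜 0 : Set A) ∪ (𝒜 1 : Set A)) = ⊤) (a : A) :
    a ∈ 𝒜 0 ⊔ 𝒜 1 * ⊤ := by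
  have h11 : 𝒜 1 ≤ 𝒜 1 * ⊤ := fun x hx => by
    simpa using Submodule.mul_mem_mul hx (Submodule.mem_top (x := (1:A)))
  have ha : a ∈ Algebra.adjoin k ((𝒜 0 : Set A) ∪ (𝒜 1 : Set A)) := hgen ▸ trivial
  induction ha using Algebra.adjoin_induction with
  | mem x hx =>
    rcases hx with hx | hx
    · exact Submodule.mem_sup_left hx
    · exact Submodule.mem_sup_right (h11 hx)
  | algebraMap r => exact Submodule.mem_sup_left (SetLike.algebraMap_mem_graded 𝒜 r)
  | add x y _ _ hx hy => exact add_mem hx hy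
  | mul x y hxa hya hx hy =>
    obtain ⟨x0, hx0, x1, hx1, rfl⟩ := Submodule.mem_sup.1 hx
    obtain ⟨y0, hy0, y1, hy1, rfl⟩ := Submodule.mem_sup.1 hy
    have e : (x0 + x1) * (y0 + y1) = x0 * y0 + (x0 * y1 + x1 * (y0 + y1)) := by noncomm_ring
    rw [e]
    refine add_mem (Submodule.mem_sup_left ?_) (Submodule.mem_sup_right (add_mem ?_ ?_))
    · simpa using SetLike.mul_mem_graded hx0 hy0
    · clear hy e hya
      induction hy1 using Submodule.mul_induction_on' with
      | mem_mul_mem m hm n hn =>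
        rw [← mul_assoc]
        exact Submodule.mul_mem_mul (by simpa using SetLike.mul_mem_graded hx0 hm) trivial
      | add p _ q _ hp hq => rw [mul_add]; exact add_mem hp hq
    · have := Submodule.mul_mem_mul hx1 (Submodule.mem_top (R := k) (x := y0 + y1))
      rw [mul_assoc] at this
      exact (mul_le_mul' le_rfl le_top : 𝒜 1 * (⊤ * ⊤) ≤ 𝒜 1 * ⊤) this

lemma one_mem_sup' (hgen : Algebra.adjoin k ((𝒜 0 : Set A) ∪ (𝒜 1 : Set A)) = ⊤) (a : A) :
    a ∈ 𝒜 0 ⊔ ⊤ * 𝒜 1 := by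
  have h11 : 𝒜 1 ≤ ⊤ * 𝒜 1 := fun x hx => by
    simpa using Submodule.mul_mem_mul (Submodule.mem_top (x := (1:A))) hx
  have ha : a ∈ Algebra.adjoin k ((𝒜 0 : Set A) ∪ (𝒜 1 : Set A)) := hgen ▸ trivial
  induction ha using Algebra.adjoin_induction with
  | mem x hx =>
    rcases hx with hx | hx
    · exact Submodule.mem_sup_left hx
    · exact Submodule.mem_sup_right (h11 hx)
  | algebraMap r => exact Submodule.mem_sup_left (SetLike.algebraMap_mem_graded 𝒜 r)
  | add x y _ _ hx hy => exact add_mem hx hy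
  | mul x y hxa hya hx hy =>
    obtain ⟨x0, hx0, x1, hx1, rfl⟩ := Submodule.mem_sup.1 hx
    obtain ⟨y0, hy0, y1, hy1, rfl⟩ := Submodule.mem_sup.1 hy
    have e : (x0 + x1) * (y0 + y1) = x0 * y0 + (x1 * y0 + (x0 + x1) * y1) := by noncomm_ring
    rw [e]
    refine add_mem (Submodule.mem_sup_left ?_) (Submodule.mem_sup_right (add_mem ?_ ?_))
    · simpa using SetLike.mul_mem_graded hx0 hy0
    · clear hx e hxa
      induction hx1 using Submodule.mul_induction_on' with
      | mem_mul_mem m hm n hn =>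
        rw [mul_assoc]
        exact Submodule.mul_mem_mul trivial (by simpa using SetLike.mul_mem_graded hn hy0)
      | add p _ q _ hp hq => rw [add_mul]; exact add_mem hp hq
    · have := Submodule.mul_mem_mul (Submodule.mem_top (R := k) (x := x0 + x1)) hy1
      rw [← mul_assoc] at this
      exact (mul_le_mul' le_top le_rfl : ⊤ * ⊤ * 𝒜 1 ≤ ⊤ * 𝒜 1) this

/-- The augmentation ideal. -/
noncomputable def augJ : Ideal A := RingHom.ker (GradedRing.projZeroRingHom' 𝒜)

noncomputable instance : (augJ 𝒜).IsTwoSided := by unfold augJ; infer_instance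

lemma mem_augJ {a : A} : a ∈ augJ 𝒜 ↔ (decompose 𝒜 a 0 : A) = 0 := by
  rw [augJ, RingHom.mem_ker, Subtype.ext_iff]; rfl

lemma augJ_ss (h : IsSemisimpleRing ↥(𝒜 0)) : IsSemisimpleRing (A ⧸ augJ 𝒜) :=
  (RingHom.quotientKerEquivOfSurjective
    (GradedRing.projZeroRingHom'_surjective 𝒜)).symm.isSemisimpleRing

lemma one_sub_augJ {n : ℕ} (hn : n ≠ 0) {a : A} (ha : a ∈ 𝒜 n) : a ∈ augJ 𝒜 := by
  rw [mem_augJ, decompose_of_mem_ne 𝒜 ha hn]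

lemma augJ_le (hgen : Algebra.adjoin k ((𝒜 0 : Set A) ∪ (𝒜 1 : Set A)) = ⊤) {a : A}
    (ha : a ∈ augJ 𝒜) : a ∈ 𝒜 1 * ⊤ := by
  obtain ⟨x0, hx0, x1, hx1, rfl⟩ := Submodule.mem_sup.1 (one_mem_sup 𝒜 hgen a)
  have h1 : x1 ∈ augJ 𝒜 := by
    clear ha
    induction hx1 using Submodule.mul_induction_on' with
    | mem_mul_mem m hm n hn => exact Ideal.mul_mem_right _ _ (one_sub_augJ 𝒜 one_ne_zero hm)
    | add p _ q _ hp hq => exact add_mem hp hq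
  have h0 : x0 ∈ augJ 𝒜 := by simpa using sub_mem ha h1
  rw [mem_augJ, decompose_of_mem_same 𝒜 hx0] at h0
  simpa [h0] using hx1

lemma augJ_le' (hgen : Algebra.adjoin k ((𝒜 0 : Set A) ∪ (𝒜 1 : Set A)) = ⊤) {a : A}
    (ha : a ∈ augJ 𝒜) : a ∈ ⊤ * 𝒜 1 := by
  obtain ⟨x0, hx0, x1, hx1, rfl⟩ := Submodule.mem_sup.1 (one_mem_sup' 𝒜 hgen a)
  have h1 : x1 ∈ augJ 𝒜 := by
    clear ha
    induction hx1 using Submodule.mul_induction_on' with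
    | mem_mul_mem m hm n hn => exact Ideal.mul_mem_left _ _ (one_sub_augJ 𝒜 one_ne_zero hn)
    | add p _ q _ hp hq => exact add_mem hp hq
  have h0 : x0 ∈ augJ 𝒜 := by simpa using sub_mem ha h1
  rw [mem_augJ, decompose_of_mem_same 𝒜 hx0] at h0
  simpa [h0] using hx1

lemma augJ_pow {a : A} (ha : a ∈ augJ 𝒜) (n : ℕ) : ∀ i < n, (decompose 𝒜 (a ^ n) i : A) = 0 := by
  classical
  induction n with
  | zero => intro i hi; omega
  | succ n ih =>
    intro i hi
    rw [pow_succ']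
    generalize a ^ n = b at ih ⊢
    conv_lhs => rw [← DirectSum.sum_support_decompose 𝒜 a, Finset.sum_mul, decompose_sum]
    rw [DFinsupp.finsetSum_apply, AddSubmonoidClass.coe_finsetSum]
    apply Finset.sum_eq_zero
    intro l hl
    by_cases hli : l ≤ i
    · rw [DirectSum.coe_decompose_mul_of_left_mem_of_le 𝒜 (SetLike.coe_mem _) hli]
      rcases Nat.eq_zero_or_pos l with rfl | h0
      · rw [(mem_augJ 𝒜).1 ha, zero_mul]
      · rw [ih _ (by omega), mul_zero]
    · rw [DirectSum.coe_decompose_mul_of_left_mem_of_not_le 𝒜 (SetLike.coe_mem _) hli]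

lemma augJ_jac [FiniteDimensional k A] : augJ 𝒜 ≤ Ring.jacobson A := by
  have hfin : {i | 𝒜 i ≠ ⊥}.Finite :=
    WellFoundedGT.finite_ne_bot_of_iSupIndep (Decomposition.isInternal 𝒜).submodule_iSupIndep
  obtain ⟨N, hN⟩ := hfin.bddAbove
  rw [Ring.jacobson_eq_sInf_isMaximal]
  refine le_sInf fun P hP => ?_
  have hP : P.IsMaximal := hP
  by_contra hle
  have hsup : P ⊔ augJ 𝒜 = ⊤ := by
    by_contra h
    exact hle (le_sup_right.trans_eq (hP.eq_of_le h le_sup_left).symm)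
  obtain ⟨p, hp, j, hj, e⟩ := Submodule.mem_sup.1 (hsup ▸ Submodule.mem_top : (1 : A) ∈ P ⊔ augJ 𝒜)
  have hnil : IsNilpotent j := by
    refine ⟨N + 1, ?_⟩
    apply (decompose 𝒜).injective
    rw [decompose_zero]
    ext i
    by_cases hi : i < N + 1
    · simpa using augJ_pow 𝒜 hj (N+1) i hi
    · have : 𝒜 i = ⊥ := by
        by_contra h
        exact hi (Nat.lt_succ_of_le (hN h))
      have h2 := (decompose 𝒜 (j ^ (N+1)) i).2
      exact (Submodule.mem_bot k).1 (this.le h2)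
  have hu : IsUnit p := by
    have : p = 1 - j := by rw [← e]; simp
    rw [this]; exact hnil.isUnit_one_sub
  exact hP.ne_top (Ideal.eq_top_of_isUnit_mem _ hp hu)
end Alg

section Mod
variable {k : Type*} [Field k] {A : Type*} [Ring A] [Algebra k A]
    (𝒜 : ℕ → Submodule k A) [GradedRing 𝒜]
    {M : Type*} [AddCommGroup M] [Module A M] [Module k M] [IsScalarTower k A M]
    (ℳ : ℤ → Submodule k M) [DirectSum.Decomposition ℳ]

/-- component -/
def hcmp (j : ℤ) (m : M) : M := (decompose ℳ m j : M)

lemma hcmp_mem (j : ℤ) (m : M) : hcmp ℳ j m ∈ ℳ j := (decompose ℳ m j).2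

lemma hcmp_add (j : ℤ) (m n : M) : hcmp ℳ j (m + n) = hcmp ℳ j m + hcmp ℳ j n := by
  simp [hcmp, decompose_add]

lemma hcmp_zero (j : ℤ) : hcmp ℳ j (0 : M) = 0 := by
  simp [hcmp, decompose_zero]

lemma hcmp_same {j : ℤ} {m : M} (h : m ∈ ℳ j) : hcmp ℳ j m = m := decompose_of_mem_same ℳ h

lemma hcmp_ne {i j : ℤ} {m : M} (h : m ∈ ℳ i) (hij : i ≠ j) : hcmp ℳ j m = 0 :=
  decompose_of_mem_ne ℳ h hij

lemma hcmp_ext {m : M} (h : ∀ j, hcmp ℳ j m = 0) : m = 0 := by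
  apply (decompose ℳ).injective
  rw [decompose_zero]
  ext j
  exact h j

lemma mem_of_cmp {m : M} (P : AddSubgroup M) (h : ∀ j, hcmp ℳ j m ∈ P) : m ∈ P := by
  classical
  rw [← DirectSum.sum_support_decompose ℳ m]
  exact sum_mem fun j _ => h j

lemma hcmp_smul (hcompat : ∀ (i : ℕ) (j : ℤ) (a : A) (m : M),
      a ∈ 𝒜 i → m ∈ ℳ j → a • m ∈ ℳ ((i : ℤ) + j)) {i : ℕ} {a : A} (ha : a ∈ 𝒜 i)
    (j : ℤ) (m : M) : hcmp ℳ j (a • m) = a • hcmp ℳ (j - i) m := by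
  induction m using DirectSum.Decomposition.inductionOn ℳ with
  | zero => simp [hcmp_zero]
  | @homogeneous l m =>
    have h := hcompat i l a m ha m.2
    by_cases e : (i : ℤ) + l = j
    · subst e
      rw [hcmp_same ℳ h]
      congr 1
      rw [add_sub_cancel_left, hcmp_same ℳ m.2]
    · rw [hcmp_ne ℳ h e, hcmp_ne ℳ m.2 (by omega), smul_zero]
  | add m n hm hn => rw [smul_add, hcmp_add, hm, hn, hcmp_add, smul_add]

/-- grading filtration -/
def gfilt (hcompat : ∀ (i : ℕ) (j : ℤ) (a : A) (m : M),
      a ∈ 𝒜 i → m ∈ ℳ j → a • m ∈ ℳ ((i : ℤ) + j)) (c : ℤ) : Submodule A M where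
  carrier := {m | ∀ j < c, hcmp ℳ j m = 0}
  add_mem' := fun {x y} hx hy j hj => by rw [hcmp_add, hx j hj, hy j hj, add_zero]
  zero_mem' := fun j _ => hcmp_zero ℳ j
  smul_mem' := fun a m hm j hj => by
    induction a using DirectSum.Decomposition.inductionOn 𝒜 with
    | zero => simp [hcmp_zero]
    | @homogeneous l a => rw [hcmp_smul 𝒜 ℳ hcompat a.2, hm _ (by omega), smul_zero]
    | add a b ha hb => rw [add_smul, hcmp_add, ha, hb, add_zero]


lemma mem_gfilt
    (hcompat : ∀ (i : ℕ) (j : ℤ) (a : A) (m : M),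
      a ∈ 𝒜 i → m ∈ ℳ j → a • m ∈ ℳ ((i : ℤ) + j))
    {c : ℤ} {m : M} : m ∈ gfilt 𝒜 ℳ hcompat c ↔ ∀ j < c, hcmp ℳ j m = 0 := Iff.rfl

lemma homog_mem_gfilt
    (hcompat : ∀ (i : ℕ) (j : ℤ) (a : A) (m : M),
      a ∈ 𝒜 i → m ∈ ℳ j → a • m ∈ ℳ ((i : ℤ) + j))
    {c j : ℤ} {m : M} (hm : m ∈ ℳ j) (h : c ≤ j) :
    m ∈ gfilt 𝒜 ℳ hcompat c := fun i hi => hcmp_ne ℳ hm (by omega)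

lemma J_gfilt
    (hcompat : ∀ (i : ℕ) (j : ℤ) (a : A) (m : M),
      a ∈ 𝒜 i → m ∈ ℳ j → a • m ∈ ℳ ((i : ℤ) + j))
    (hgen : Algebra.adjoin k ((𝒜 0 : Set A) ∪ (𝒜 1 : Set A)) = ⊤)
    {c : ℤ} {m : M} (hm : m ∈ gfilt 𝒜 ℳ hcompat c) {a : A} (ha : a ∈ augJ 𝒜) :
    a • m ∈ gfilt 𝒜 ℳ hcompat (c+1) := by
  replace ha := augJ_le' 𝒜 hgen ha
  induction ha using Submodule.mul_induction_on' with
  | mem_mul_mem y _ b hb =>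
    rw [mul_smul]
    apply Submodule.smul_mem
    intro j hj
    rw [hcmp_smul 𝒜 ℳ hcompat hb, hm _ (by push_cast; omega), smul_zero]
  | add p _ q _ hp hq => rw [add_smul]; exact add_mem hp hq

/-- `𝒜 1 • ℳ (j-1)` -/
def Bj (j : ℤ) : AddSubgroup M :=
  AddSubgroup.closure {x | ∃ a ∈ 𝒜 1, ∃ m ∈ ℳ (j-1), x = a • m}

lemma Bj_le
    (hcompat : ∀ (i : ℕ) (j : ℤ) (a : A) (m : M),
      a ∈ 𝒜 i → m ∈ ℳ j → a • m ∈ ℳ ((i : ℤ) + j))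
    {c j : ℤ} (h : c ≤ j - 1) {x : M} (hx : x ∈ Bj 𝒜 ℳ j) :
    x ∈ augJ 𝒜 • gfilt 𝒜 ℳ hcompat c := by
  have : Bj 𝒜 ℳ j ≤ (augJ 𝒜 • gfilt 𝒜 ℳ hcompat c).toAddSubgroup := by
    refine (AddSubgroup.closure_le _).2 ?_
    rintro _ ⟨a, ha, m, hm, rfl⟩
    exact Submodule.smul_mem_smul (one_sub_augJ 𝒜 one_ne_zero ha)
      (homog_mem_gfilt 𝒜 ℳ hcompat hm h)
  exact this hx

lemma Bj_zero {j : ℤ} (h : ℳ (j - 1) = ⊥) {x : M} (hx : x ∈ Bj 𝒜 ℳ j) : x = 0 := by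
  have : Bj 𝒜 ℳ j ≤ ⊥ := by
    refine (AddSubgroup.closure_le _).2 ?_
    rintro _ ⟨a, ha, m, hm, rfl⟩
    rw [h, Submodule.mem_bot] at hm
    simp [hm]
  simpa using this hx

lemma hcmp_mem_Bj
    (hcompat : ∀ (i : ℕ) (j : ℤ) (a : A) (m : M),
      a ∈ 𝒜 i → m ∈ ℳ j → a • m ∈ ℳ ((i : ℤ) + j))
    (hgen : Algebra.adjoin k ((𝒜 0 : Set A) ∪ (𝒜 1 : Set A)) = ⊤)
    {x : M} (hx : x ∈ augJ 𝒜 • (⊤ : Submodule A M)) (j : ℤ) : hcmp ℳ j x ∈ Bj 𝒜 ℳ j := by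
  induction hx using Submodule.smul_induction_on' with
  | smul a ha m _ =>
    replace ha := augJ_le 𝒜 hgen ha
    induction ha using Submodule.mul_induction_on' with
    | mem_mul_mem b hb y _ =>
      rw [mul_smul, hcmp_smul 𝒜 ℳ hcompat hb]
      exact AddSubgroup.subset_closure ⟨b, hb, hcmp ℳ (j-1) (y • m), hcmp_mem ℳ _ _, by simp⟩
    | add p _ q _ hp hq => rw [add_smul, hcmp_add]; exact add_mem hp hq
  | add p _ q _ hp hq => rw [hcmp_add]; exact add_mem hp hq

/-- Generated in a single degree. -/
lemma top_degree
    (hcompat : ∀ (i : ℕ) (j : ℤ) (a : A) (m : M),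
      a ∈ 𝒜 i → m ∈ ℳ j → a • m ∈ ℳ ((i : ℤ) + j))
    (hgen : Algebra.adjoin k ((𝒜 0 : Set A) ∪ (𝒜 1 : Set A)) = ⊤)
    (htop : IsCoatom (augJ 𝒜 • (⊤ : Submodule A M))) :
    ∃ t : ℤ, ℳ t ≠ ⊥ ∧ ∀ j ≠ t, ∀ m ∈ ℳ j, m ∈ Bj 𝒜 ℳ j := by
  have h1 : ∃ t, ∃ m ∈ ℳ t, m ∉ augJ 𝒜 • (⊤ : Submodule A M) := by
    by_contra! h
    apply htop.1
    rw [eq_top_iff]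
    intro m _
    exact mem_of_cmp ℳ (augJ 𝒜 • (⊤ : Submodule A M)).toAddSubgroup
      fun j => h j _ (hcmp_mem ℳ j m)
  obtain ⟨t, m0, hm0, hm0'⟩ := h1
  refine ⟨t, ?_, ?_⟩
  · intro h
    rw [h, Submodule.mem_bot] at hm0
    exact hm0' (hm0 ▸ zero_mem _)
  let P : Submodule A M :=
    { carrier := {x | ∀ j ≠ t, hcmp ℳ j x ∈ augJ 𝒜 • (⊤ : Submodule A M)}
      add_mem' := fun {x y} hx hy j hj => by
        rw [hcmp_add]; exact add_mem (hx j hj) (hy j hj)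
      zero_mem' := fun j _ => by rw [hcmp_zero]; exact zero_mem _
      smul_mem' := fun a x hx j hj => by
        induction a using DirectSum.Decomposition.inductionOn 𝒜 with
        | zero => rw [zero_smul, hcmp_zero]; exact zero_mem _
        | @homogeneous l a =>
          rw [hcmp_smul 𝒜 ℳ hcompat a.2]
          by_cases e : j - l = t
          · exact Submodule.smul_mem_smul
              (one_sub_augJ 𝒜 (n := l) (by rintro rfl; apply hj; simpa using e) a.2) trivial
          · exact Submodule.smul_mem _ _ (hx _ e)
        | add a b ha hb => rw [add_smul, hcmp_add]; exact add_mem ha hb }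
  have hP : P = ⊤ := by
    apply htop.2
    refine lt_of_le_of_ne ?_ ?_
    · intro x hx j hj
      exact Submodule.smul_mono le_rfl le_top
        (Bj_le 𝒜 ℳ hcompat le_rfl (hcmp_mem_Bj 𝒜 ℳ hcompat hgen hx j))
    · intro h
      apply hm0'
      rw [h]
      intro j hj
      rw [hcmp_ne ℳ hm0 hj.symm]
      exact zero_mem _
  intro j hj m hm
  have h1 : m ∈ P := hP ▸ trivial
  have h2 := h1 j hj
  rw [hcmp_same ℳ hm] at h2
  have h3 := hcmp_mem_Bj 𝒜 ℳ hcompat hgen h2 j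
  rwa [hcmp_same ℳ hm] at h3

lemma J_mem_iff (hgen : Algebra.adjoin k ((𝒜 0 : Set A) ∪ (𝒜 1 : Set A)) = ⊤)
    (N : Submodule A M) (m : M) :
    (∀ a ∈ augJ 𝒜, a • m ∈ N) ↔ ∀ a ∈ 𝒜 1, a • m ∈ N := by
  constructor
  · intro h a ha
    exact h a (one_sub_augJ 𝒜 one_ne_zero ha)
  · intro h a ha
    replace ha := augJ_le' 𝒜 hgen ha
    induction ha using Submodule.mul_induction_on' with
    | mem_mul_mem y _ b hb =>
      rw [mul_smul]
      exact Submodule.smul_mem _ _ (h b hb)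
    | add p _ q _ hp hq => rw [add_smul]; exact add_mem hp hq

lemma soc_degree
    (hcompat : ∀ (i : ℕ) (j : ℤ) (a : A) (m : M),
      a ∈ 𝒜 i → m ∈ ℳ j → a • m ∈ ℳ ((i : ℤ) + j))
    (K : Submodule A M) (hK : ∀ m, m ∈ K ↔ ∀ a ∈ augJ 𝒜, a • m = 0)
    (hK' : ∀ m, m ∈ K ↔ ∀ a ∈ 𝒜 1, a • m = 0) (hsoc : IsAtom K) :
    ∃ s : ℤ, ∀ j ≠ s, ∀ m ∈ ℳ j, (∀ a ∈ 𝒜 1, a • m = 0) → m = 0 := by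
  obtain ⟨m0, hm0, hne⟩ := Submodule.exists_mem_ne_zero_of_ne_bot hsoc.1
  obtain ⟨s, hs⟩ : ∃ s, hcmp ℳ s m0 ≠ 0 := by
    by_contra! h
    exact hne (hcmp_ext ℳ h)
  refine ⟨s, ?_⟩
  let P : Submodule A M :=
    { carrier := {x | x ∈ K ∧ ∀ j ≠ s, hcmp ℳ j x = 0}
      add_mem' := fun {x y} hx hy => ⟨add_mem hx.1 hy.1, fun j hj => by
        rw [hcmp_add, hx.2 j hj, hy.2 j hj, add_zero]⟩
      zero_mem' := ⟨zero_mem _, fun j _ => hcmp_zero ℳ j⟩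
      smul_mem' := fun a x hx => ⟨Submodule.smul_mem _ _ hx.1, fun j hj => by
        induction a using DirectSum.Decomposition.inductionOn 𝒜 with
        | zero => rw [zero_smul, hcmp_zero]
        | @homogeneous l a =>
          rcases Nat.eq_zero_or_pos l with rfl | hl
          · rw [hcmp_smul 𝒜 ℳ hcompat a.2, hx.2 _ (by simpa using hj), smul_zero]
          · rw [(hK x).1 hx.1 a (one_sub_augJ 𝒜 hl.ne' a.2), hcmp_zero]
        | add a b ha hb => rw [add_smul, hcmp_add, ha, hb, add_zero]⟩ }
  have hcs : hcmp ℳ s m0 ∈ P := by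
    refine ⟨(hK' _).2 fun a ha => ?_, fun j hj => hcmp_ne ℳ (hcmp_mem ℳ s m0) hj.symm⟩
    have := hcmp_smul 𝒜 ℳ hcompat ha (s + 1) m0
    rw [(hK' m0).1 hm0 a ha, hcmp_zero] at this
    simpa using this.symm
  have hP : P = K := by
    rcases hsoc.le_iff.1 (show P ≤ K from fun x hx => hx.1) with h | h
    · rw [h] at hcs
      exact absurd ((Submodule.mem_bot A).1 hcs) hs
    · exact h
  intro j hj m hm ha
  have h1 : m ∈ P := hP ▸ (hK' m).2 ha
  have := h1.2 j hj
  rwa [hcmp_same ℳ hm] at this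

end Mod
end Mine

/-- over a finite dimensional graded algebra with `A_0` semisimple and
generated by `A_0, A_1`, a finite dimensional graded module with simple top and simple
socle is rigid: its socle and radical filtrations coincide. -/
theorem stmt8 (k : Type) [Field k] (A : Type) [Ring A] [Algebra k A]
    [FiniteDimensional k A]
    (𝒜 : ℕ → Submodule k A) [GradedRing 𝒜] (hA0 : IsSemisimpleRing ↥(𝒜 0))
    (hgen : Algebra.adjoin k ((𝒜 0 : Set A) ∪ (𝒜 1 : Set A)) = ⊤)
    (M : Type) [AddCommGroup M] [Module A M] [Module k M] [IsScalarTower k A M]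
    [FiniteDimensional k M]
    (ℳ : ℤ → Submodule k M) [DirectSum.Decomposition ℳ]
    (hcompat : ∀ (i : ℕ) (j : ℤ) (a : A) (m : M),
      a ∈ 𝒜 i → m ∈ ℳ j → a • m ∈ ℳ ((i : ℤ) + j))
    (htop : IsSimpleModule A (M ⧸ radFilt A M 1))
    (hsoc : IsSimpleModule A ↥(socFilt A M 1))
    (d : ℕ) (hd : d = loewyLength A M) :
    ∀ i : ℕ, i ≤ d → socFilt A M i = radFilt A M (d - i) := by
  classical
  have hss := augJ_ss 𝒜 hA0
  have hJ := augJ_jac 𝒜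
  -- top
  have hr1 : radFilt A M 1 = augJ 𝒜 • (⊤ : Submodule A M) := rad_succ (augJ 𝒜) hss hJ M 0
  rw [isSimpleModule_iff_isCoatom, hr1] at htop
  obtain ⟨t, hMt, ht⟩ := top_degree 𝒜 ℳ hcompat hgen htop
  -- socle
  rw [isSimpleModule_iff_isAtom] at hsoc
  have hK : ∀ m, m ∈ socFilt A M 1 ↔ ∀ a ∈ augJ 𝒜, a • m = 0 := fun m => by
    rw [mem_soc_succ (augJ 𝒜) hss hJ M 0 m]; rfl
  have hK' : ∀ m, m ∈ socFilt A M 1 ↔ ∀ a ∈ 𝒜 1, a • m = 0 := fun m => by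
    rw [mem_soc_succ (augJ 𝒜) hss hJ M 0 m, J_mem_iff 𝒜 hgen]; rfl
  obtain ⟨s, hs⟩ := soc_degree 𝒜 ℳ hcompat _ hK hK' hsoc
  -- bounds
  have hfin : {i | ℳ i ≠ ⊥}.Finite :=
    WellFoundedGT.finite_ne_bot_of_iSupIndep
      (DirectSum.Decomposition.isInternal ℳ).submodule_iSupIndep
  obtain ⟨N, hN⟩ := hfin.bddAbove
  obtain ⟨L, hL⟩ := hfin.bddBelow
  have hlow : ∀ n : ℕ, ∀ j : ℤ, j < L + n → j < t → ℳ j = ⊥ := by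
    intro n
    induction n with
    | zero =>
      intro j hj _
      by_contra h
      have := hL h
      push_cast at hj
      omega
    | succ n ih =>
      intro j hj hjt
      rw [eq_bot_iff]
      intro m hm
      exact (Submodule.mem_bot k).2
        (Bj_zero 𝒜 ℳ (ih (j-1) (by push_cast at hj; omega) (by omega)) (ht j hjt.ne m hm))
  have hlow' : ∀ j < t, ℳ j = ⊥ := fun j hj => hlow (j - L + 1).toNat j (by omega) hj
  have hhigh : ∀ n : ℕ, ∀ j : ℤ, N - n < j → s < j → ℳ j = ⊥ := by
    intro n
    induction n with
    | zero =>
      intro j hj _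
      by_contra h
      have := hN h
      push_cast at hj
      omega
    | succ n ih =>
      intro j hj hjs
      rw [eq_bot_iff]
      intro m hm
      refine (Submodule.mem_bot k).2 (hs j hjs.ne' m hm fun a ha => ?_)
      have h1 := hcompat 1 j a m ha hm
      rw [ih _ (by push_cast at hj ⊢; omega) (by push_cast; omega)] at h1
      exact (Submodule.mem_bot k).1 h1
  have hhigh' : ∀ j > s, ℳ j = ⊥ := fun j hj => hhigh (N - j + 1).toNat j (by omega) hj
  have hts : t ≤ s := by
    by_contra h
    exact hMt (hhigh' t (by omega))
  have hcz : ∀ j, ℳ j = ⊥ → ∀ m, hcmp ℳ j m = 0 := fun j hj m =>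
    (Submodule.mem_bot k).1 (hj.le (hcmp_mem ℳ j m))
  let G := gfilt 𝒜 ℳ hcompat
  have hGtop : G t = ⊤ := by
    rw [eq_top_iff]
    intro m _ j hj
    exact hcz j (hlow' j hj) m
  have hGbot : ∀ c, s < c → G c = ⊥ := by
    intro c hc
    rw [eq_bot_iff]
    intro m hm
    refine (Submodule.mem_bot A).2 (hcmp_ext ℳ fun j => ?_)
    by_cases hj : j < c
    · exact hm j hj
    · exact hcz j (hhigh' j (by omega)) m
  have hrad : ∀ n : ℕ, radFilt A M n = G (t + n) := by
    intro n
    induction n with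
    | zero => simp only [Nat.cast_zero, add_zero, hGtop]; rfl
    | succ n ih =>
      rw [rad_succ (augJ 𝒜) hss hJ M n, ih]
      apply le_antisymm
      · refine Submodule.smul_le.2 fun a ha m hm => ?_
        have := J_gfilt 𝒜 ℳ hcompat hgen hm ha
        rw [add_assoc] at this
        exact_mod_cast this
      · intro m hm
        refine mem_of_cmp ℳ (augJ 𝒜 • G (t + n)).toAddSubgroup fun j => ?_
        by_cases hj : j < t + ((n + 1 : ℕ) : ℤ)
        · rw [hm j hj]; exact zero_mem _
        · push_cast at hj
          exact Bj_le 𝒜 ℳ hcompat (by omega) (ht j (by omega) _ (hcmp_mem ℳ j m))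
  have hsocG : ∀ n : ℕ, socFilt A M n = G (s + 1 - n) := by
    intro n
    induction n with
    | zero => rw [hGbot _ (by push_cast; omega)]; rfl
    | succ n ih =>
      ext m
      rw [mem_soc_succ (augJ 𝒜) hss hJ M n, ih]
      constructor
      · intro h j hj
        push_cast at hj
        refine hs j (by omega) _ (hcmp_mem ℳ j m) fun a ha => ?_
        have h1 := h a (one_sub_augJ 𝒜 one_ne_zero ha) (j + 1) (by omega)
        rw [hcmp_smul 𝒜 ℳ hcompat ha] at h1
        simpa using h1
      · intro h a ha
        have := J_gfilt 𝒜 ℳ hcompat hgen h ha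
        have e : s + 1 - ((n + 1 : ℕ) : ℤ) + 1 = s + 1 - n := by push_cast; ring
        rw [e] at this
        exact this
  -- there is a nonzero element of degree `s`
  have hMs : ℳ s ≠ ⊥ := by
    intro h
    apply hsoc.1
    rw [hsocG 1, eq_bot_iff]
    intro m hm
    refine (Submodule.mem_bot A).2 (hcmp_ext ℳ fun j => ?_)
    rcases lt_trichotomy j s with hj | hj | hj
    · exact hm j (by push_cast; omega)
    · exact hcz j (hj ▸ h) m
    · exact hcz j (hhigh' j hj) m
  have hD : d = (s + 1 - t).toNat := by
    rw [hd, loewyLength]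
    have hmem : (s + 1 - t).toNat ∈
        {n : ℕ | ∃ F : Fin (n+1) → Submodule A M, IsSemisimpleFiltration A M F} := by
      refine ⟨fun i => G (s + 1 - (i : ℕ)), ?_, ?_, ?_, ?_⟩
      · intro i j hij m hm l hl
        have : (i : ℕ) ≤ j := hij
        exact hm l (by omega)
      · exact hGbot _ (by simp)
      · have : s + 1 - (((Fin.last (s + 1 - t).toNat : Fin _) : ℕ) : ℤ) = t := by
          rw [Fin.val_last]; omega
        simp only [this, hGtop]
      · intro i
        apply ss_of_killed (augJ 𝒜) hss
        apply quot_killed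
        intro a ha m hm
        have := J_gfilt 𝒜 ℳ hcompat hgen hm ha
        have e : s + 1 - ((i.succ : ℕ) : ℤ) + 1 = s + 1 - ((i.castSucc : ℕ) : ℤ) := by
          simp
          ring
        rw [e] at this
        exact this
    apply le_antisymm (Nat.sInf_le hmem)
    refine le_csInf ⟨_, hmem⟩ ?_
    rintro n ⟨F, hmono, h0, hl, hF⟩
    have key : ∀ i : ℕ, (hi : i ≤ n) → radFilt A M i ≤ F ⟨n - i, by omega⟩ := by
      intro i
      induction i with
      | zero =>
        intro _
        have : F ⟨n - 0, by omega⟩ = ⊤ := hl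
        rw [this]; exact le_top
      | succ i ih =>
        intro hi
        rw [rad_succ (augJ 𝒜) hss hJ M i]
        refine Submodule.smul_le.2 fun a ha m hm => ?_
        have hlt : n - (i+1) < n := by omega
        have h1 := hF ⟨n - (i+1), hlt⟩
        have h2 := of_quot_killed (augJ 𝒜) _
          (F (Fin.castSucc ⟨n - (i+1), hlt⟩)) (killed_of_ss (augJ 𝒜) hJ _) a ha m
          (show m ∈ F (Fin.succ ⟨n - (i+1), hlt⟩) from ?_)
        · exact h2
        · have e : (Fin.succ ⟨n - (i+1), hlt⟩ : Fin (n+1)) = ⟨n - i, by omega⟩ := by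
            ext; simp; omega
          rw [e]
          exact ih (by omega) hm
    have hn := key n le_rfl
    have e : (⟨n - n, by omega⟩ : Fin (n+1)) = 0 := by ext; simp
    rw [e, h0, hrad] at hn
    by_contra hlt
    apply hMs
    rw [eq_bot_iff]
    intro m hm
    exact (Submodule.mem_bot k).2 ((Submodule.mem_bot A).1
      (hn (homog_mem_gfilt 𝒜 ℳ hcompat hm (by omega))))
  intro i hi
  rw [hsocG, hrad]
  congr 1
  omega
end
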